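/- Let G be a strongly effective Hausdorff ample groupoid and k a field. Then the correspondence U ↦ I(U) := span_k{1_B : B a compact open bisection with d(B) ⊆ U} is a lattice isomorphism from the lattice of open invariant subsets of the unit space G⁰ onto the lattice of two-sided ideals of the Steinberg algebra A_k(G). -/

import Mathlib

open Set Function

/-- A groupoid structure on a type `G`: a small category in which every morphism is
invertible, encoded with a total multiplication `mul` that is only meaningful on
composable pairs.  Here `d x = x⁻¹x` and `r x = xx⁻¹`, and a pair `(x, y)` is
composable exactly when `d x = r y`. -/
structure GroupoidStr (G : Type*) where
  mul : G → G → G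
  inv : G → G
  inv_inv : ∀ x, inv (inv x) = x
  /-- `x · d x = x` -/
  mul_d : ∀ x, mul x (mul (inv x) x) = x
  /-- `r x · x = x` -/
  r_mul : ∀ x, mul (mul x (inv x)) x = x
  /-- associativity on composable pairs -/
  assoc : ∀ x y z, mul (inv x) x = mul y (inv y) → mul (inv y) y = mul z (inv z) →
    mul (mul x y) z = mul x (mul y z)
  /-- `d (xy) = d y` for composable `x, y` -/
  d_comp : ∀ x y, mul (inv x) x = mul y (inv y) →
    mul (inv (mul x y)) (mul x y) = mul (inv y) y
  /-- `r (xy) = r x` for composable `x, y` -/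
  r_comp : ∀ x y, mul (inv x) x = mul y (inv y) →
    mul (mul x y) (inv (mul x y)) = mul x (inv x)
  /-- `(xy)⁻¹ = y⁻¹x⁻¹` for composable `x, y` -/
  inv_mul : ∀ x y, mul (inv x) x = mul y (inv y) → inv (mul x y) = mul (inv y) (inv x)
  /-- units are their own inverses -/
  unit_self_inv : ∀ x, inv (mul (inv x) x) = mul (inv x) x
  /-- units are idempotents -/
  unit_idem : ∀ x, mul (mul (inv x) x) (mul (inv x) x) = mul (inv x) x

namespace GroupoidStr

variable {G : Type*} (S : GroupoidStr G)

/-- The domain (source) `d x = x⁻¹ x` of `x`. -/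
def d (x : G) : G := S.mul (S.inv x) x

/-- The range `r x = x x⁻¹` of `x`. -/
def r (x : G) : G := S.mul x (S.inv x)

/-- The unit space `G⁰ = d(G) = r(G)`. -/
def unitSpace : Set G := Set.range S.d

/-- The isotropy bundle `Iso(G) = {x | d x = r x}`. -/
def IsoSet : Set G := {x | S.d x = S.r x}

/-- The orbit of a unit `u`: `{r γ : d γ = u}`. -/
def orbit (u : G) : Set G := S.r '' {γ : G | S.d γ = u}

/-- A subset `U` of the unit space is invariant if `d γ ∈ U` implies `r γ ∈ U`. -/
def IsInvariant (U : Set G) : Prop := ∀ γ : G, S.d γ ∈ U → S.r γ ∈ U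

section Top

variable [TopologicalSpace G]

/-- `G` is a topological groupoid: inversion and composition (on the set of composable
pairs, with the relative product topology) are continuous. -/
def IsTopological : Prop :=
  Continuous S.inv ∧
    Continuous fun p : {p : G × G // S.d p.1 = S.r p.2} => S.mul p.1.1 p.1.2

/-- An open bisection: an open set on which both `d` and `r` restrict to homeomorphisms
onto open subsets of the unit space. -/
def IsOpenBisection (U : Set G) : Prop :=
  IsOpen U ∧ Set.InjOn S.d U ∧ Set.InjOn S.r U ∧
    (∀ V ⊆ U, IsOpen V → IsOpen (S.d '' V)) ∧ (∀ V ⊆ U, IsOpen V → IsOpen (S.r '' V))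

/-- An étale groupoid: there is a basis of open bisections (equivalently, `d` is a local
homeomorphism). -/
def IsEtale : Prop := ∀ x : G, ∃ U, x ∈ U ∧ S.IsOpenBisection U

/-- An ample groupoid: there is a basis of compact open bisections. -/
def IsAmple : Prop :=
  ∀ (x : G) (W : Set G), x ∈ W → IsOpen W →
    ∃ U, x ∈ U ∧ U ⊆ W ∧ IsCompact U ∧ S.IsOpenBisection U

def IsCompactOpenBisection (U : Set G) : Prop := IsCompact U ∧ S.IsOpenBisection U

/-- `G` is effective if the interior of the isotropy bundle is the unit space. -/
def IsEffective : Prop := interior S.IsoSet = S.unitSpace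

variable (R : Type*) [CommRing R]

/-- The underlying set of the Steinberg algebra `A_R(G)`: locally constant,
compactly supported `R`-valued functions on `G`.  (The groupoid structure argument is
only used for the `A_R(G)` notation `S.SteinSet R`.) -/
def SteinSet (_Sg : GroupoidStr G) : Set (G → R) :=
  {f | IsLocallyConstant f ∧ HasCompactSupport f}

variable {R}

/-- Convolution: `(f * g) γ = ∑_{αβ = γ} f α * g β`. -/
noncomputable def conv (f g : G → R) : G → R := fun γ =>
  ∑ᶠ p ∈ {p : G × G | S.d p.1 = S.r p.2 ∧ S.mul p.1 p.2 = γ}, f p.1 * g p.2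

end Top

end GroupoidStr

namespace GroupoidStr

variable {G : Type*} [TopologicalSpace G] (S : GroupoidStr G)
variable {R : Type*} [CommRing R]

/-- A (two-sided, ring) ideal of the Steinberg algebra `A_R(G)`. -/
def IsIdealOf (I : Set (G → R)) : Prop :=
  I ⊆ S.SteinSet R ∧ (0 : G → R) ∈ I ∧
    (∀ f ∈ I, ∀ g ∈ I, f - g ∈ I) ∧
    (∀ f ∈ I, ∀ g ∈ S.SteinSet R, S.conv f g ∈ I ∧ S.conv g f ∈ I)

/-- A subset of the unit space which is open in the relative topology of `G⁰`. -/
def IsRelOpen (U : Set G) : Prop :=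
  U ⊆ S.unitSpace ∧ ∃ W : Set G, IsOpen W ∧ U = W ∩ S.unitSpace

end GroupoidStr

namespace GroupoidStr

variable {G : Type*} [TopologicalSpace G] (S : GroupoidStr G)

/-- The restriction `G|_D = {γ : d γ ∈ D, r γ ∈ D}` of the groupoid to a set `D`. -/
def restrictG (D : Set G) : Set G := {γ : G | S.d γ ∈ D ∧ S.r γ ∈ D}

/-- The interior of `A` relative to the subspace `B` (as a subset of `B`). -/
def relInt (_Sg : GroupoidStr G) (B A : Set G) : Set G :=
  {x : G | x ∈ B ∧ ∃ V : Set G, IsOpen V ∧ x ∈ V ∧ V ∩ B ⊆ A}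

/-- `G` is strongly effective: for every nonempty (relatively) closed invariant subset
`D` of `G⁰`, the restricted groupoid `G|_D` is effective, i.e. the interior (relative
to `G|_D`) of its isotropy bundle is its unit space `D`. -/
def IsStronglyEffective : Prop :=
  ∀ D : Set G, D ⊆ S.unitSpace → D.Nonempty →
    (∃ C : Set G, IsClosed C ∧ D = C ∩ S.unitSpace) → S.IsInvariant D →
    S.relInt (S.restrictG D) (S.IsoSet ∩ S.restrictG D) = D

variable (R : Type*) [CommRing R]

/-- The ideal `I(U) = span { 1_B : B a compact open bisection with d(B) ⊆ U }` of the
Steinberg algebra associated to an (open invariant) subset `U` of the unit space. -/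
def idealOf (U : Set G) : Set (G → R) :=
  (Submodule.span R {f : G → R | ∃ B : Set G,
      S.IsCompactOpenBisection B ∧ S.d '' B ⊆ U ∧
      f = B.indicator (fun _ => (1 : R))} : Submodule R (G → R))

end GroupoidStr

namespace GroupoidStr

section Algebra

variable {G : Type*} (S : GroupoidStr G)

lemma d_inv (x : G) : S.d (S.inv x) = S.r x := by
  simp only [d, r, S.inv_inv]

lemma r_inv (x : G) : S.r (S.inv x) = S.d x := by
  simp only [d, r, S.inv_inv]

lemma r_d (x : G) : S.r (S.d x) = S.d x := by
  have h1 := S.unit_self_inv x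
  have h2 := S.unit_idem x
  simp only [d, r] at *
  rw [h1, h2]

lemma d_d (x : G) : S.d (S.d x) = S.d x := by
  have h1 := S.unit_self_inv x
  have h2 := S.unit_idem x
  simp only [d] at *
  rw [h1, h2]

lemma d_r (x : G) : S.d (S.r x) = S.r x := by
  rw [← S.d_inv, S.d_d]

lemma r_r (x : G) : S.r (S.r x) = S.r x := by
  rw [← S.d_inv x, S.r_d]

lemma mem_unitSpace_iff {x : G} : x ∈ S.unitSpace ↔ S.d x = x :=
  ⟨by rintro ⟨y, rfl⟩; exact S.d_d y, fun h => ⟨x, h⟩⟩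

lemma d_mem_unitSpace (x : G) : S.d x ∈ S.unitSpace := ⟨x, rfl⟩

lemma r_mem_unitSpace (x : G) : S.r x ∈ S.unitSpace := ⟨S.inv x, S.d_inv x⟩

lemma d_of_mem_unitSpace {x : G} (h : x ∈ S.unitSpace) : S.d x = x :=
  S.mem_unitSpace_iff.1 h

lemma r_of_mem_unitSpace {x : G} (h : x ∈ S.unitSpace) : S.r x = x := by
  obtain ⟨y, rfl⟩ := h
  exact S.r_d y

lemma mul_d_self (x : G) : S.mul x (S.d x) = x := S.mul_d x

lemma r_mul_self (x : G) : S.mul (S.r x) x = x := S.r_mul x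

lemma d_mul {x y : G} (h : S.d x = S.r y) : S.d (S.mul x y) = S.d y := S.d_comp x y h

lemma r_mul' {x y : G} (h : S.d x = S.r y) : S.r (S.mul x y) = S.r x := S.r_comp x y h

lemma inv_mul_cancel_left {x y : G} (h : S.d x = S.r y) :
    S.mul (S.inv x) (S.mul x y) = y := by
  rw [← S.assoc (S.inv x) x y (S.d_inv x) h]
  change S.mul (S.d x) y = y
  rw [h, S.r_mul_self]

lemma mul_inv_cancel_left {x y : G} (h : S.r x = S.r y) :
    S.mul x (S.mul (S.inv x) y) = y := by
  have := S.inv_mul_cancel_left (x := S.inv x) (y := y) (by rw [S.d_inv, h])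
  rwa [S.inv_inv] at this

lemma IsInvariant.r_mem_iff {S : GroupoidStr G} {U : Set G} (hU : S.IsInvariant U) (x : G) :
    S.r x ∈ U ↔ S.d x ∈ U := by
  refine ⟨fun h => ?_, hU x⟩
  rw [← S.r_inv]
  exact hU _ (by rwa [S.d_inv])

variable {R : Type*} [CommRing R]

lemma exists_of_conv_ne_zero {f g : G → R} {γ : G} (h : S.conv f g γ ≠ 0) :
    ∃ α β, S.d α = S.r β ∧ S.mul α β = γ ∧ f α ≠ 0 ∧ g β ≠ 0 := by
  obtain ⟨p, hp, hne⟩ := exists_ne_zero_of_finsum_mem_ne_zero h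
  exact ⟨p.1, p.2, hp.1, hp.2, left_ne_zero_of_mul hne, right_ne_zero_of_mul hne⟩

lemma conv_eq_of_unique_left {f g : G → R} {α γ : G} (hr : S.r α = S.r γ)
    (huniq : ∀ α', f α' ≠ 0 → S.r α' = S.r γ → α' = α) :
    S.conv f g γ = f α * g (S.mul (S.inv α) γ) := by
  have hc : S.d (S.inv α) = S.r γ := by rw [S.d_inv, hr]
  rw [conv, finsum_mem_def, finsum_eq_single _ (α, S.mul (S.inv α) γ)]
  · refine indicator_of_mem (s := {p : G × G | S.d p.1 = S.r p.2 ∧ S.mul p.1 p.2 = γ}) ⟨?_, ?_⟩ _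
    · change S.d α = S.r (S.mul (S.inv α) γ)
      rw [S.r_mul' hc, S.r_inv]
    · exact S.mul_inv_cancel_left hr
  · rintro ⟨α', β'⟩ hne
    by_contra h
    have hmem := mem_of_indicator_ne_zero h
    rw [indicator_of_mem hmem] at h
    obtain ⟨h1, h2⟩ := hmem
    dsimp only at h1 h2
    have hα : α' = α := huniq α' (left_ne_zero_of_mul h) (by rw [← h2, S.r_mul' h1])
    subst hα
    apply hne
    rw [← h2, S.inv_mul_cancel_left h1]

lemma conv_indicator_units {V : Set G} (hV : V ⊆ S.unitSpace) (f : G → R) (γ : G) :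
    S.conv f (V.indicator fun _ => (1 : R)) γ =
      f γ * V.indicator (fun _ => (1 : R)) (S.d γ) := by
  rw [conv, finsum_mem_def, finsum_eq_single _ (γ, S.d γ)]
  · refine indicator_of_mem (s := {p : G × G | S.d p.1 = S.r p.2 ∧ S.mul p.1 p.2 = γ}) ⟨?_, ?_⟩ _
    · exact (S.r_d γ).symm
    · exact S.mul_d_self γ
  · rintro ⟨α, β⟩ hne
    by_contra h
    have hmem := mem_of_indicator_ne_zero h
    rw [indicator_of_mem hmem] at h
    obtain ⟨h1, h2⟩ := hmem
    dsimp only at h1 h2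
    have hβ := hV (mem_of_indicator_ne_zero (right_ne_zero_of_mul h))
    dsimp only at hβ
    rw [S.r_of_mem_unitSpace hβ] at h1
    rw [← h1, S.mul_d_self] at h2
    apply hne
    rw [← h1, h2]

lemma indicator_units_conv {V : Set G} (hV : V ⊆ S.unitSpace) (c : R) (f : G → R) (γ : G) :
    S.conv (V.indicator fun _ => c) f γ = V.indicator (fun _ => c) (S.r γ) * f γ := by
  rw [S.conv_eq_of_unique_left (S.r_r γ)]
  · congr 2
    have := S.inv_mul_cancel_left (x := S.r γ) (y := γ) (S.d_r γ)
    rwa [S.r_mul_self] at this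
  · intro α hα h
    rw [← h, S.r_of_mem_unitSpace (hV (mem_of_indicator_ne_zero hα))]

end Algebra

section Topology

open Topology

variable {G : Type*} [TopologicalSpace G] {S : GroupoidStr G}

lemma IsTopological.continuous_d (hT : S.IsTopological) : Continuous S.d :=
  hT.2.comp (Continuous.subtype_mk (f := fun x => (S.inv x, x))
    (hT.1.prodMk continuous_id) S.d_inv)

lemma IsTopological.continuous_r (hT : S.IsTopological) : Continuous S.r := by
  have : S.r = S.d ∘ S.inv := funext fun x => (S.d_inv x).symm
  rw [this]
  exact hT.continuous_d.comp hT.1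

lemma IsTopological.exists_mul_mem (hT : S.IsTopological) {x y : G} (h : S.d x = S.r y)
    {W : Set G} (hW : IsOpen W) (hxy : S.mul x y ∈ W) :
    ∃ P Q : Set G, IsOpen P ∧ IsOpen Q ∧ x ∈ P ∧ y ∈ Q ∧
      ∀ a ∈ P, ∀ b ∈ Q, S.d a = S.r b → S.mul a b ∈ W := by
  obtain ⟨O, hO, hOW⟩ := isOpen_induced_iff.1 (hW.preimage hT.2)
  have hmem : (x, y) ∈ O := by
    have : (⟨(x, y), h⟩ : {p : G × G // S.d p.1 = S.r p.2}) ∈ Subtype.val ⁻¹' O := by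
      rw [hOW]; exact hxy
    exact this
  obtain ⟨P, Q, hP, hQ, hx, hy, hPQ⟩ := isOpen_prod_iff.1 hO x y hmem
  refine ⟨P, Q, hP, hQ, hx, hy, fun a ha b hb hab => ?_⟩
  have : (⟨(a, b), hab⟩ : {p : G × G // S.d p.1 = S.r p.2}) ∈ Subtype.val ⁻¹' O :=
    hPQ ⟨ha, hb⟩
  rw [hOW] at this
  exact this

lemma IsTopological.isCompact_mul [T2Space G] (hT : S.IsTopological) {A B : Set G}
    (hA : IsCompact A) (hB : IsCompact B) :
    IsCompact {γ | ∃ α ∈ A, ∃ β ∈ B, S.d α = S.r β ∧ S.mul α β = γ} := by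
  have hcl : IsClosed {p : G × G | S.d p.1 = S.r p.2} :=
    isClosed_eq (hT.continuous_d.comp continuous_fst) (hT.continuous_r.comp continuous_snd)
  have hK := hcl.isClosedEmbedding_subtypeVal.isCompact_preimage (hA.prod hB)
  convert hK.image hT.2 using 1
  ext γ
  constructor
  · rintro ⟨α, hα, β, hβ, h, rfl⟩
    exact ⟨⟨(α, β), h⟩, ⟨hα, hβ⟩, rfl⟩
  · rintro ⟨⟨⟨α, β⟩, h⟩, ⟨hα, hβ⟩, rfl⟩
    exact ⟨α, hα, β, hβ, h, rfl⟩

lemma IsAmple.isOpen_unitSpace (hA : S.IsAmple) : IsOpen S.unitSpace := by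
  rw [isOpen_iff_mem_nhds]
  intro x hx
  obtain ⟨U, hxU, -, -, hU⟩ := hA x univ trivial isOpen_univ
  refine Filter.mem_of_superset
    ((hU.2.2.2.1 U Subset.rfl hU.1).mem_nhds ⟨x, hxU, S.d_of_mem_unitSpace hx⟩) ?_
  rintro _ ⟨y, -, rfl⟩
  exact S.d_mem_unitSpace y

lemma IsTopological.isClosed_unitSpace [T2Space G] (hT : S.IsTopological) :
    IsClosed S.unitSpace := by
  have : S.unitSpace = {x | S.d x = x} := by ext; exact S.mem_unitSpace_iff
  rw [this]
  exact isClosed_eq hT.continuous_d continuous_id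

lemma IsAmple.isOpen_of_isRelOpen (hA : S.IsAmple) {U : Set G} (hU : S.IsRelOpen U) :
    IsOpen U := by
  obtain ⟨-, W, hW, rfl⟩ := hU
  exact hW.inter hA.isOpen_unitSpace

lemma IsCompactOpenBisection.isClopen [T2Space G] {B : Set G} (hB : S.IsCompactOpenBisection B) :
    IsClopen B :=
  ⟨hB.1.isClosed, hB.2.1⟩

lemma IsCompactOpenBisection.mono {A B : Set G} (hB : S.IsCompactOpenBisection B)
    (hAB : A ⊆ B) (hA : IsClopen A) : S.IsCompactOpenBisection A :=
  ⟨hB.1.of_isClosed_subset hA.1 hAB, hA.2, hB.2.2.1.mono hAB, hB.2.2.2.1.mono hAB,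
    fun V hV => hB.2.2.2.2.1 V (hV.trans hAB), fun V hV => hB.2.2.2.2.2 V (hV.trans hAB)⟩

variable {R : Type*} [CommRing R]

lemma isLocallyConstant_indicator {B : Set G} (hB : IsClopen B) {f : G → R}
    (hf : IsLocallyConstant f) : IsLocallyConstant (B.indicator f) := by
  rw [IsLocallyConstant.iff_eventually_eq]
  intro x
  by_cases hx : x ∈ B
  · filter_upwards [hB.2.mem_nhds hx, hf.eventually_eq x] with y hy hyx
    rw [indicator_of_mem hy, indicator_of_mem hx, hyx]
  · filter_upwards [hB.compl.2.mem_nhds hx] with y hy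
    rw [indicator_of_notMem hy, indicator_of_notMem hx]

lemma mem_steinSet_of_support_subset [T2Space G] {f : G → R} (hf : IsLocallyConstant f)
    {K : Set G} (hK : IsCompact K) (h : support f ⊆ K) : f ∈ S.SteinSet R :=
  ⟨hf, HasCompactSupport.of_support_subset_isCompact hK h⟩

lemma isClopen_support {f : G → R} (hf : f ∈ S.SteinSet R) : IsClopen (support f) :=
  (hf.1.isClopen_fiber 0).compl

lemma isCompact_support {f : G → R} (hf : f ∈ S.SteinSet R) : IsCompact (support f) := by
  have := hf.2
  rwa [HasCompactSupport, tsupport, (isClopen_support hf).1.closure_eq] at this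

lemma indicator_mem_steinSet [T2Space G] {B : Set G} (hB : IsOpen B) (hc : IsCompact B) (c : R) :
    B.indicator (fun _ => c) ∈ S.SteinSet R :=
  mem_steinSet_of_support_subset
    (isLocallyConstant_indicator ⟨hc.isClosed, hB⟩ (IsLocallyConstant.const c)) hc
    support_indicator_subset

lemma zero_mem_steinSet : (0 : G → R) ∈ S.SteinSet R :=
  ⟨IsLocallyConstant.const 0, HasCompactSupport.zero⟩

lemma add_mem_steinSet [T2Space G] {f g : G → R} (hf : f ∈ S.SteinSet R)
    (hg : g ∈ S.SteinSet R) : f + g ∈ S.SteinSet R :=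
  mem_steinSet_of_support_subset (hf.1.add hg.1)
    ((isCompact_support hf).union (isCompact_support hg)) (support_add f g)

lemma smul_mem_steinSet [T2Space G] (c : R) {f : G → R} (hf : f ∈ S.SteinSet R) :
    c • f ∈ S.SteinSet R :=
  mem_steinSet_of_support_subset (hf.1.comp (c * ·)) (isCompact_support hf)
    fun _ hx h => hx (by simp [h])

lemma sub_mem_steinSet [T2Space G] {f g : G → R} (hf : f ∈ S.SteinSet R)
    (hg : g ∈ S.SteinSet R) : f - g ∈ S.SteinSet R :=
  mem_steinSet_of_support_subset (hf.1.sub hg.1)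
    ((isCompact_support hf).union (isCompact_support hg)) (support_sub f g)

/-- A function in the Steinberg algebra belongs to any additive submonoid that contains all
multiples of indicators of sufficiently small compact open bisections in its support. -/
lemma IsAmple.mem_of_forall_exists_isOpen [T2Space G] (hA : S.IsAmple) {f : G → R}
    (hf : f ∈ S.SteinSet R) (M : AddSubmonoid (G → R))
    (h : ∀ γ, f γ ≠ 0 → ∃ W, IsOpen W ∧ γ ∈ W ∧ ∀ B ⊆ W, S.IsCompactOpenBisection B →
      ∀ c : R, B.indicator (fun _ => c) ∈ M) : f ∈ M := by
  have key : ∃ T, IsClopen T ∧ support f ⊆ T ∧ ∀ C, IsClopen C → (C ∩ T).indicator f ∈ M := by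
    refine (isCompact_support hf).induction_on
      (p := fun s => ∃ T, IsClopen T ∧ s ⊆ T ∧ ∀ C, IsClopen C → (C ∩ T).indicator f ∈ M)
      ⟨∅, isClopen_empty, Subset.rfl, fun C _ => by
        rw [inter_empty, indicator_empty']; exact M.zero_mem⟩ ?_ ?_ ?_
    · rintro s t hst ⟨T, hT, htT, hM⟩
      exact ⟨T, hT, hst.trans htT, hM⟩
    · rintro s t ⟨T, hT, hsT, hM⟩ ⟨T', hT', htT', hM'⟩
      refine ⟨T ∪ T', hT.union hT', union_subset_union hsT htT', fun C hC => ?_⟩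
      have : (C ∩ (T ∪ T')).indicator f = (C ∩ T).indicator f + ((C \ T) ∩ T').indicator f := by
        refine Eq.trans ?_ (indicator_union_of_disjoint ?_ f)
        · congr 1
          ext x
          simp only [mem_inter_iff, mem_union, mem_sdiff]
          tauto
        · rw [Set.disjoint_left]
          rintro x ⟨-, hx⟩ ⟨⟨-, hx'⟩, -⟩
          exact hx' hx
      rw [this]
      exact M.add_mem (hM C hC) (hM' _ (hC.diff hT))
    · intro γ hγ
      obtain ⟨W, hW, hγW, hM⟩ := h γ hγ
      obtain ⟨B, hγB, hBW, hBc, hB⟩ := hA γ (W ∩ {x | f x = f γ}) ⟨hγW, rfl⟩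
        (hW.inter (hf.1.isOpen_fiber _))
      have hcob : S.IsCompactOpenBisection B := ⟨hBc, hB⟩
      refine ⟨B, mem_nhdsWithin_of_mem_nhds (hB.1.mem_nhds hγB), B, hcob.isClopen, Subset.rfl,
        fun C hC => ?_⟩
      have : (C ∩ B).indicator f = (C ∩ B).indicator fun _ => f γ := by
        refine indicator_congr fun x hx => ?_
        exact (hBW hx.2).2
      rw [this]
      exact hM _ (fun x hx => (hBW hx.2).1)
        (hcob.mono inter_subset_right (hC.inter hcob.isClopen)) _
  obtain ⟨T, -, hfT, hM⟩ := key
  have := hM univ isClopen_univ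
  rwa [univ_inter, indicator_eq_self.2 hfT] at this

lemma conv_indicator_mem_steinSet [T2Space G] (hT : S.IsTopological) {A : Set G}
    (hA : S.IsCompactOpenBisection A) (c : R) {g : G → R} (hg : g ∈ S.SteinSet R) :
    S.conv (A.indicator fun _ => c) g ∈ S.SteinSet R := by
  have hconv : ∀ α ∈ A, ∀ γ, S.r α = S.r γ →
      S.conv (A.indicator fun _ => c) g γ = c * g (S.mul (S.inv α) γ) := by
    intro α hα γ h
    rw [S.conv_eq_of_unique_left h, indicator_of_mem hα]
    intro α' hα' h'
    exact hA.2.2.2.1 (mem_of_indicator_ne_zero hα') hα (h'.trans h.symm)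
  refine mem_steinSet_of_support_subset ?_ (hT.isCompact_mul hA.1 (isCompact_support hg)) ?_
  · rw [IsLocallyConstant.iff_eventually_eq]
    intro γ
    by_cases hγ : S.r γ ∈ S.r '' A
    · obtain ⟨α, hα, h⟩ := hγ
      obtain ⟨P, Q, hP, hQ, hαP, hγQ, hPQ⟩ := hT.exists_mul_mem (x := S.inv α) (y := γ)
        (by rw [S.d_inv, h]) (hg.1.isOpen_fiber (g (S.mul (S.inv α) γ))) rfl
      have hO : IsOpen (S.r '' (A ∩ S.inv ⁻¹' P)) :=
        hA.2.2.2.2.2 _ inter_subset_left (hA.2.1.inter (hP.preimage hT.1))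
      filter_upwards [hQ.mem_nhds hγQ,
        (hO.preimage hT.continuous_r).mem_nhds ⟨α, ⟨hα, hαP⟩, h⟩] with γ' hγ' hr
      obtain ⟨α', ⟨hα', hαP'⟩, h'⟩ := hr
      rw [hconv α' hα' γ' h', hconv α hα γ h]
      congr 1
      exact hPQ _ hαP' _ hγ' (by rw [S.d_inv, h'])
    · have hzero : ∀ γ', S.r γ' ∉ S.r '' A → S.conv (A.indicator fun _ => c) g γ' = 0 := by
        intro γ' h
        by_contra hne
        obtain ⟨α, β, h1, h2, hα, -⟩ := S.exists_of_conv_ne_zero hne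
        exact h ⟨α, mem_of_indicator_ne_zero hα, by rw [← h2, S.r_mul' h1]⟩
      have hcl : IsClosed (S.r '' A) := (hA.1.image hT.continuous_r).isClosed
      filter_upwards [(hcl.isOpen_compl.preimage hT.continuous_r).mem_nhds hγ] with γ' h
      rw [hzero γ' h, hzero γ hγ]
  · intro γ hγ
    obtain ⟨α, β, h1, h2, hα, hβ⟩ := S.exists_of_conv_ne_zero hγ
    exact ⟨α, mem_of_indicator_ne_zero hα, β, hβ, h1, h2⟩

lemma conv_mem_steinSet [T2Space G] (hT : S.IsTopological) (hA : S.IsAmple) {f g : G → R}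
    (hf : f ∈ S.SteinSet R) (hg : g ∈ S.SteinSet R) : S.conv f g ∈ S.SteinSet R := by
  let M : AddSubmonoid (G → R) :=
    { carrier := {f | (∀ γ, ({p : G × G | S.d p.1 = S.r p.2 ∧ S.mul p.1 p.2 = γ} ∩
          support fun p => f p.1 * g p.2).Finite) ∧ S.conv f g ∈ S.SteinSet R}
      zero_mem' := by
        refine ⟨fun γ => ?_, ?_⟩
        · convert Set.finite_empty (α := G × G)
          ext p
          simp
        · convert zero_mem_steinSet (S := S) (R := R) using 1
          ext γ
          simp [conv]
      add_mem' := by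
        rintro f f' ⟨h1, h2⟩ ⟨h1', h2'⟩
        refine ⟨fun γ => ((h1 γ).union (h1' γ)).subset ?_, ?_⟩
        · rintro p ⟨hp, hne⟩
          by_cases h : f p.1 * g p.2 = 0
          · refine Or.inr ⟨hp, fun h' => hne ?_⟩
            simp only [Pi.add_apply, add_mul]
            rw [h, zero_add]
            exact h'
          · exact Or.inl ⟨hp, h⟩
        · convert add_mem_steinSet h2 h2' using 1
          ext γ
          simp only [Pi.add_apply, conv, add_mul]
          exact finsum_mem_add_distrib' (h1 γ) (h1' γ) }
  refine (hA.mem_of_forall_exists_isOpen hf M fun γ _ => ⟨univ, isOpen_univ, trivial,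
    fun B _ hB c => ⟨fun γ => ?_, conv_indicator_mem_steinSet hT hB c hg⟩⟩).2
  refine Set.Subsingleton.finite ?_
  rintro ⟨α, β⟩ ⟨⟨h1, h2⟩, hne⟩ ⟨α', β'⟩ ⟨⟨h1', h2'⟩, hne'⟩
  dsimp only at h1 h2 h1' h2'
  have hα : α ∈ B := mem_of_indicator_ne_zero (left_ne_zero_of_mul hne)
  have hα' : α' ∈ B := mem_of_indicator_ne_zero (left_ne_zero_of_mul hne')
  have : α = α' := hB.2.2.2.1 hα hα' (by rw [← S.r_mul' h1, ← S.r_mul' h1', h2, h2'])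
  subst this
  rw [← S.inv_mul_cancel_left h1, ← S.inv_mul_cancel_left h1', h2, h2']

lemma IsAmple.idealOf_eq [T2Space G] (hT : S.IsTopological) (hA : S.IsAmple) {U : Set G}
    (hU : S.IsRelOpen U) :
    S.idealOf R U = {f | f ∈ S.SteinSet R ∧ ∀ γ, f γ ≠ 0 → S.d γ ∈ U} := by
  apply Subset.antisymm
  · intro f hf
    refine Submodule.span_induction
      (p := fun f _ => f ∈ S.SteinSet R ∧ ∀ γ, f γ ≠ 0 → S.d γ ∈ U) ?_ ?_ ?_ ?_ hf
    · rintro _ ⟨B, hB, hBU, rfl⟩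
      exact ⟨indicator_mem_steinSet hB.2.1 hB.1 1,
        fun γ hγ => hBU ⟨γ, mem_of_indicator_ne_zero hγ, rfl⟩⟩
    · exact ⟨zero_mem_steinSet, fun γ h => absurd rfl h⟩
    · rintro f g - - ⟨hf, hfU⟩ ⟨hg, hgU⟩
      refine ⟨add_mem_steinSet hf hg, fun γ h => ?_⟩
      by_cases h' : f γ = 0
      · exact hgU γ fun h'' => h (by rw [Pi.add_apply, h', h'', add_zero])
      · exact hfU γ h'
    · rintro c f - ⟨hf, hfU⟩
      exact ⟨smul_mem_steinSet c hf, fun γ h => hfU γ (right_ne_zero_of_mul h)⟩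
  · rintro f ⟨hf, hfU⟩
    refine hA.mem_of_forall_exists_isOpen hf (Submodule.toAddSubmonoid (Submodule.span R _))
      fun γ hγ => ⟨S.d ⁻¹' U, (hA.isOpen_of_isRelOpen hU).preimage hT.continuous_d, hfU γ hγ,
        fun B hBU hB c => ?_⟩
    have : B.indicator (fun _ => c) = c • B.indicator (fun _ => (1 : R)) := by
      ext x
      by_cases hx : x ∈ B <;> simp [hx]
    rw [this]
    exact Submodule.smul_mem _ c
      (Submodule.subset_span ⟨B, hB, image_subset_iff.2 hBU, rfl⟩)

lemma IsAmple.isIdealOf_idealOf [T2Space G] (hT : S.IsTopological) (hA : S.IsAmple) {U : Set G}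
    (hU : S.IsRelOpen U) (hinv : S.IsInvariant U) : S.IsIdealOf (S.idealOf R U) := by
  rw [hA.idealOf_eq hT hU]
  refine ⟨fun f hf => hf.1, ⟨zero_mem_steinSet, fun γ h => absurd rfl h⟩, ?_, ?_⟩
  · rintro f ⟨hf, hfU⟩ g ⟨hg, hgU⟩
    refine ⟨sub_mem_steinSet hf hg, fun γ h => ?_⟩
    by_cases h' : f γ = 0
    · exact hgU γ fun h'' => h (by rw [Pi.sub_apply, h', h'', sub_zero])
    · exact hfU γ h'
  · rintro f ⟨hf, hfU⟩ g hg
    refine ⟨⟨conv_mem_steinSet hT hA hf hg, fun γ h => ?_⟩,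
      ⟨conv_mem_steinSet hT hA hg hf, fun γ h => ?_⟩⟩
    · obtain ⟨α, β, h1, rfl, hα, -⟩ := S.exists_of_conv_ne_zero h
      rw [S.d_mul h1, ← hinv.r_mem_iff, ← h1]
      exact hfU α hα
    · obtain ⟨α, β, h1, rfl, -, hβ⟩ := S.exists_of_conv_ne_zero h
      rw [S.d_mul h1]
      exact hfU β hβ

lemma IsAmple.subset_of_idealOf_subset [T2Space G] [Nontrivial R] (hT : S.IsTopological)
    (hA : S.IsAmple) {U V : Set G} (hU : S.IsRelOpen U) (hV : S.IsRelOpen V)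
    (h : S.idealOf R U ⊆ S.idealOf R V) : U ⊆ V := by
  intro x hx
  obtain ⟨B, hxB, hBU, hBc, hB⟩ := hA x U hx (hA.isOpen_of_isRelOpen hU)
  have hmem : B.indicator (fun _ => (1 : R)) ∈ S.idealOf R U := by
    refine Submodule.subset_span ⟨B, ⟨hBc, hB⟩, ?_, rfl⟩
    rintro _ ⟨y, hy, rfl⟩
    rw [S.d_of_mem_unitSpace (hU.1 (hBU hy))]
    exact hBU hy
  have h' := h hmem
  rw [hA.idealOf_eq hT hV] at h'
  have := h'.2 x (by rw [indicator_of_mem hxB]; exact one_ne_zero)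
  rwa [S.d_of_mem_unitSpace (hU.1 hx)] at this

lemma idealOf_mono {U V : Set G} (h : U ⊆ V) : S.idealOf R U ⊆ S.idealOf R V := by
  refine Submodule.span_mono ?_
  rintro _ ⟨B, hB, hBU, rfl⟩
  exact ⟨B, hB, hBU.trans h, rfl⟩

/-- The open set of units attached to a set of functions: the union of all compact open sets of
units whose indicator function belongs to it. -/
def unitSupport (S : GroupoidStr G) (I : Set (G → R)) : Set G :=
  {u | ∃ V, IsOpen V ∧ IsCompact V ∧ V ⊆ S.unitSpace ∧ u ∈ V ∧
    V.indicator (fun _ => (1 : R)) ∈ I}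

lemma isOpen_unitSupport (I : Set (G → R)) : IsOpen (S.unitSupport I) := by
  rw [isOpen_iff_mem_nhds]
  rintro u ⟨V, hV, hVc, hVu, huV, hI⟩
  exact Filter.mem_of_superset (hV.mem_nhds huV) fun v hv => ⟨V, hV, hVc, hVu, hv, hI⟩

lemma isRelOpen_unitSupport (I : Set (G → R)) : S.IsRelOpen (S.unitSupport I) := by
  have hsub : S.unitSupport I ⊆ S.unitSpace := by
    rintro u ⟨V, -, -, hVu, huV, -⟩
    exact hVu huV
  exact ⟨hsub, _, isOpen_unitSupport I, (inter_eq_left.2 hsub).symm⟩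

lemma IsIdealOf.conv_right_mem {I : Set (G → R)} (hI : S.IsIdealOf I) {f g : G → R}
    (hf : f ∈ I) (hg : g ∈ S.SteinSet R) : S.conv f g ∈ I := (hI.2.2.2 f hf g hg).1

lemma IsIdealOf.conv_left_mem {I : Set (G → R)} (hI : S.IsIdealOf I) {f g : G → R}
    (hf : f ∈ S.SteinSet R) (hg : g ∈ I) : S.conv f g ∈ I := (hI.2.2.2 g hg f hf).2

/-- An ideal of the Steinberg algebra as an additive submonoid of the space of functions. -/
def IsIdealOf.toAddSubmonoid {I : Set (G → R)} (hI : S.IsIdealOf I) : AddSubmonoid (G → R) where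
  carrier := I
  zero_mem' := hI.2.1
  add_mem' := fun {f g} hf hg => by
    have := hI.2.2.1 f hf (0 - g) (hI.2.2.1 0 hI.2.1 g hg)
    rwa [zero_sub, sub_neg_eq_add] at this

/-- If the indicator of a compact open set `V` of units lies in an ideal, then so do all multiples
of indicators of compact open sets with domain in `V`. -/
lemma IsIdealOf.indicator_mem [T2Space G] {I : Set (G → R)} (hI : S.IsIdealOf I)
    {V B : Set G} (hVu : V ⊆ S.unitSpace) (hVI : V.indicator (fun _ => (1 : R)) ∈ I)
    (hB : IsOpen B) (hBc : IsCompact B) (hBV : B ⊆ S.d ⁻¹' V) (c : R) :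
    B.indicator (fun _ => c) ∈ I := by
  have : S.conv (B.indicator fun _ => c) (V.indicator fun _ => (1 : R)) =
      B.indicator fun _ => c := by
    ext γ
    rw [S.conv_indicator_units hVu]
    by_cases hγ : γ ∈ B
    · rw [indicator_of_mem (s := V) (hBV hγ), mul_one]
    · rw [indicator_of_notMem hγ, zero_mul]
  rw [← this]
  exact hI.conv_left_mem (indicator_mem_steinSet hB hBc c) hVI

lemma isOpen_preimage_inv (hT : S.IsTopological) {A : Set G} (hA : IsOpen A) :
    IsOpen (S.inv ⁻¹' A) := hA.preimage hT.1

lemma isCompact_preimage_inv (hT : S.IsTopological) {A : Set G} (hA : IsCompact A) :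
    IsCompact (S.inv ⁻¹' A) := by
  rw [← image_eq_preimage_of_inverse S.inv_inv S.inv_inv]
  exact hA.image hT.1

lemma IsIdealOf.isInvariant_unitSupport [T2Space G] (hT : S.IsTopological) (hA : S.IsAmple)
    {I : Set (G → R)} (hI : S.IsIdealOf I) : S.IsInvariant (S.unitSupport I) := by
  rintro γ ⟨V, hV, hVc, hVu, hγV, hVI⟩
  obtain ⟨A, hγA, hAV, hAc, hAb⟩ := hA γ (S.d ⁻¹' V) hγV (hV.preimage hT.continuous_d)
  have hAI := hI.indicator_mem hVu hVI hAb.1 hAc hAV 1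
  refine ⟨S.r '' A, hAb.2.2.2.2 A Subset.rfl hAb.1, hAc.image hT.continuous_r, ?_,
    ⟨γ, hγA, rfl⟩, ?_⟩
  · rintro _ ⟨x, -, rfl⟩
    exact S.r_mem_unitSpace x
  · have : S.conv (A.indicator fun _ => (1 : R)) ((S.inv ⁻¹' A).indicator fun _ => (1 : R)) =
        (S.r '' A).indicator fun _ => (1 : R) := by
      ext x
      by_cases hx : S.r x ∈ S.r '' A
      · obtain ⟨α, hα, h⟩ := hx
        rw [S.conv_eq_of_unique_left h fun α' hα' h' =>
          hAb.2.2.1 (mem_of_indicator_ne_zero hα') hα (h'.trans h.symm),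
          indicator_of_mem hα, one_mul]
        have hc : S.d (S.inv α) = S.r x := by rw [S.d_inv, h]
        have hiff : S.mul (S.inv α) x ∈ S.inv ⁻¹' A ↔ x ∈ S.r '' A := by
          constructor
          · intro hmem
            have hd : S.d (S.inv (S.mul (S.inv α) x)) = S.d α := by
              rw [S.d_inv, S.r_mul' hc, S.r_inv]
            have heq := hAb.2.1 hmem hα hd
            refine ⟨α, hα, ?_⟩
            have h2 := S.mul_inv_cancel_left h
            rw [← S.inv_inv (S.mul (S.inv α) x), heq] at h2
            exact h2
          · rintro ⟨β, hβ, rfl⟩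
            rw [S.r_r] at h
            rw [hAb.2.2.1 hβ hα h.symm, mem_preimage]
            have : S.mul (S.inv α) (S.r α) = S.inv α := by
              rw [← S.d_inv, S.mul_d_self]
            rwa [this, S.inv_inv]
        by_cases hx : x ∈ S.r '' A
        · rw [indicator_of_mem hx, indicator_of_mem (hiff.2 hx)]
        · rw [indicator_of_notMem hx, indicator_of_notMem (mt hiff.1 hx)]
      · rw [indicator_of_notMem]
        · by_contra hne
          obtain ⟨α, β, h1, h2, hα, -⟩ := S.exists_of_conv_ne_zero hne
          exact hx ⟨α, mem_of_indicator_ne_zero hα, by rw [← h2, S.r_mul' h1]⟩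
        · rintro ⟨α, hα, rfl⟩
          exact hx ⟨α, hα, (S.r_r α).symm⟩
    rw [← this]
    exact hI.conv_right_mem hAI
      (indicator_mem_steinSet (isOpen_preimage_inv hT hAb.1) (isCompact_preimage_inv hT hAc) 1)

lemma IsIdealOf.idealOf_unitSupport_subset [T2Space G] (hT : S.IsTopological) (hA : S.IsAmple)
    {I : Set (G → R)} (hI : S.IsIdealOf I) : S.idealOf R (S.unitSupport I) ⊆ I := by
  rw [hA.idealOf_eq hT (isRelOpen_unitSupport I)]
  rintro f ⟨hf, hfU⟩
  refine hA.mem_of_forall_exists_isOpen hf hI.toAddSubmonoid fun γ hγ => ?_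
  obtain ⟨V, hV, -, hVu, hγV, hVI⟩ := hfU γ hγ
  exact ⟨S.d ⁻¹' V, hV.preimage hT.continuous_d, hγV,
    fun B hBV hB c => hI.indicator_mem hVu hVI hB.2.1 hB.1 hBV c⟩

/-- In a strongly effective groupoid, a compact set of non-units can be avoided over some compact
open set of units meeting a given closed invariant set `D`. -/
lemma IsStronglyEffective.exists_avoiding [T2Space G] (hT : S.IsTopological) (hA : S.IsAmple)
    (hSE : S.IsStronglyEffective) {D : Set G} (hD : D ⊆ S.unitSpace) (hDc : IsClosed D)
    (hinv : S.IsInvariant D) {K : Set G} (hK : IsCompact K) (hKu : Disjoint K S.unitSpace)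
    {V : Set G} (hV : IsOpen V) (hVu : V ⊆ S.unitSpace) (hVc : IsCompact V)
    (hVD : (V ∩ D).Nonempty) :
    ∃ V' ⊆ V, IsOpen V' ∧ IsCompact V' ∧ (V' ∩ D).Nonempty ∧
      ∀ γ ∈ K, S.d γ ∈ V' ∩ D → S.r γ ∉ V' := by
  refine hK.induction_on
    (p := fun s => ∀ V ⊆ S.unitSpace, IsOpen V → IsCompact V → (V ∩ D).Nonempty →
      ∃ V' ⊆ V, IsOpen V' ∧ IsCompact V' ∧ (V' ∩ D).Nonempty ∧
      ∀ γ ∈ s, S.d γ ∈ V' ∩ D → S.r γ ∉ V') ?_ ?_ ?_ ?_ V hVu hV hVc hVD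
  · intro V _ hV hVc hVD
    exact ⟨V, Subset.rfl, hV, hVc, hVD, fun γ hγ => absurd hγ (notMem_empty γ)⟩
  · intro s t hst ht V hVu hV hVc hVD
    obtain ⟨V', h1, h2, h3, h4, h5⟩ := ht V hVu hV hVc hVD
    exact ⟨V', h1, h2, h3, h4, fun γ hγ => h5 γ (hst hγ)⟩
  · intro s t hs ht V hVu hV hVc hVD
    obtain ⟨V', h1, h2, h3, h4, h5⟩ := hs V hVu hV hVc hVD
    obtain ⟨V'', h1', h2', h3', h4', h5'⟩ := ht V' (h1.trans hVu) h2 h3 h4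
    refine ⟨V'', h1'.trans h1, h2', h3', h4', ?_⟩
    rintro γ (hγ | hγ) hd hr
    · exact h5 γ hγ ⟨h1' hd.1, hd.2⟩ (h1' hr)
    · exact h5' γ hγ hd hr
  · intro γ₀ hγ₀
    obtain ⟨B, hγB, hBu, -, hB⟩ := hA γ₀ S.unitSpaceᶜ (Set.disjoint_left.1 hKu hγ₀)
      hT.isClosed_unitSpace.isOpen_compl
    refine ⟨B, mem_nhdsWithin_of_mem_nhds (hB.1.mem_nhds hγB), ?_⟩
    intro V hVu hV hVc hVD
    by_cases hex : ∃ γ ∈ B, S.d γ ∈ V ∩ D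
    · obtain ⟨γ, hγ, hγV, hγD⟩ := hex
      have hnot : γ ∉ S.relInt (S.restrictG D) (S.IsoSet ∩ S.restrictG D) := by
        rw [hSE D hD ⟨_, hγD⟩ ⟨D, hDc, (inter_eq_left.2 hD).symm⟩ hinv]
        exact fun h => hBu hγ (hD h)
      have hexγ : ∃ γ' ∈ B, S.d γ' ∈ V ∧ S.d γ' ∈ D ∧ S.d γ' ≠ S.r γ' := by
        by_contra! hall
        refine hnot ⟨⟨hγD, hinv γ hγD⟩, B ∩ S.d ⁻¹' V,
          hB.1.inter (hV.preimage hT.continuous_d), ⟨hγ, hγV⟩, ?_⟩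
        rintro x ⟨⟨hxB, hxV⟩, hxD⟩
        exact ⟨hall x hxB hxV hxD.1, hxD⟩
      obtain ⟨γ', hγ'B, hγ'V, hγ'D, hne⟩ := hexγ
      obtain ⟨O₁, O₂, hO₁, hO₂, hd, hr, hdisj⟩ := t2_separation hne
      have hopen : IsOpen (S.d '' (B ∩ (S.d ⁻¹' (V ∩ O₁) ∩ S.r ⁻¹' O₂))) :=
        hB.2.2.2.1 _ inter_subset_left (hB.1.inter
          (((hV.inter hO₁).preimage hT.continuous_d).inter (hO₂.preimage hT.continuous_r)))
      obtain ⟨V', hdV', hV'sub, hV'c, hV'b⟩ := hA (S.d γ') _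
        (mem_image_of_mem S.d (show γ' ∈ B ∩ (S.d ⁻¹' (V ∩ O₁) ∩ S.r ⁻¹' O₂) from
          ⟨hγ'B, ⟨hγ'V, hd⟩, hr⟩)) hopen
      have hV'VO : V' ⊆ V ∩ O₁ := by
        intro x hx
        obtain ⟨β, hβ, rfl⟩ := hV'sub hx
        exact hβ.2.1
      refine ⟨V', fun x hx => (hV'VO hx).1, hV'b.1, hV'c, ⟨_, hdV', hγ'D⟩, ?_⟩
      intro δ hδB hδ hδr
      obtain ⟨β, hβ, hβδ⟩ := hV'sub hδ.1
      have : β = δ := hB.2.1 hβ.1 hδB hβδ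
      subst this
      exact Set.disjoint_left.1 hdisj (hV'VO hδr).2 hβ.2.2
    · exact ⟨V, Subset.rfl, hV, hVc, hVD, fun γ hγ h _ => hex ⟨γ, hγ, h⟩⟩

lemma IsIdealOf.subset_idealOf_unitSupport {k : Type*} [Field k] [T2Space G]
    (hT : S.IsTopological) (hA : S.IsAmple) (hSE : S.IsStronglyEffective)
    {I : Set (G → k)} (hI : S.IsIdealOf I) : I ⊆ S.idealOf k (S.unitSupport I) := by
  have hUo := isOpen_unitSupport (S := S) I
  have hUinv := hI.isInvariant_unitSupport hT hA
  have hle := hI.idealOf_unitSupport_subset hT hA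
  rw [hA.idealOf_eq hT (isRelOpen_unitSupport I)] at hle ⊢
  intro f hf
  refine ⟨hI.1 hf, fun γ hγ => ?_⟩
  by_contra hγU
  obtain ⟨B, hγB, -, hBc, hB⟩ := hA γ univ trivial isOpen_univ
  have hBi := indicator_mem_steinSet (S := S) (R := k) (isOpen_preimage_inv hT hB.1)
    (isCompact_preimage_inv hT hBc) 1
  obtain ⟨g, hg, hgγ⟩ : ∃ g ∈ I, g (S.d γ) ≠ 0 := by
    refine ⟨_, hI.conv_left_mem hBi hf, ?_⟩
    have hmem : S.inv γ ∈ S.inv ⁻¹' B := by rwa [mem_preimage, S.inv_inv]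
    rw [S.conv_eq_of_unique_left (α := S.inv γ) (by rw [S.r_inv, S.r_d]), indicator_of_mem hmem,
      one_mul, S.inv_inv, S.mul_d_self]
    · exact hγ
    · intro α hα h
      have hα' : S.inv α ∈ B := mem_of_indicator_ne_zero (s := S.inv ⁻¹' B) hα
      have : S.inv α = γ := hB.2.1 hα' hγB (by rw [S.d_inv, h, S.r_d])
      rw [← this, S.inv_inv]
  set D : Set G := S.unitSpace \ S.unitSupport I
  have hDinv : S.IsInvariant D := fun x hx =>
    ⟨S.r_mem_unitSpace x, fun h => hx.2 ((hUinv.r_mem_iff x).1 h)⟩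
  have hDc : IsClosed D := hT.isClosed_unitSpace.sdiff hUo
  have hgS := hI.1 hg
  set c := g (S.d γ)
  obtain ⟨V₀, hγV₀, hV₀, hV₀c, hV₀b⟩ := hA (S.d γ) (S.unitSpace ∩ {x | g x = c})
    ⟨S.d_mem_unitSpace γ, rfl⟩ (hA.isOpen_unitSpace.inter (hgS.1.isOpen_fiber _))
  obtain ⟨V, hVV₀, hV, hVc, ⟨u, huV, huD⟩, havoid⟩ :=
    hSE.exists_avoiding hT hA (D := D) sdiff_subset hDc hDinv
      (K := support g \ S.unitSpace)
      ((isCompact_support hgS).diff hA.isOpen_unitSpace) disjoint_sdiff_left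
      hV₀b.1 (fun x hx => (hV₀ hx).1) hV₀c ⟨_, hγV₀, S.d_mem_unitSpace γ, hγU⟩
  have hVu : V ⊆ S.unitSpace := fun x hx => (hV₀ (hVV₀ hx)).1
  have hVS (a : k) : V.indicator (fun _ => a) ∈ S.SteinSet k := indicator_mem_steinSet hV hVc a
  set w : G → k := S.conv (S.conv (V.indicator fun _ => 1) g) (V.indicator fun _ => 1) with hw
  have hwI : w ∈ I := hI.conv_right_mem (hI.conv_left_mem (hVS 1) hg) (hVS 1)
  have hwapp (x : G) : w x =
      V.indicator (fun _ => 1) (S.r x) * g x * V.indicator (fun _ => 1) (S.d x) := by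
    rw [hw, S.conv_indicator_units hVu, S.indicator_units_conv hVu]
  have hdiff : w - V.indicator (fun _ => c) ∈ I := by
    refine hle ⟨sub_mem_steinSet (hI.1 hwI) (hVS c), fun x hx => ?_⟩
    by_contra hxU
    apply hx
    rw [Pi.sub_apply, hwapp]
    by_cases hxu : x ∈ S.unitSpace
    · rw [S.d_of_mem_unitSpace hxu, S.r_of_mem_unitSpace hxu]
      by_cases hxV : x ∈ V
      · have : g x = c := (hV₀ (hVV₀ hxV)).2
        simp [hxV, this]
      · simp [hxV]
    · have hxV : x ∉ V := fun h => hxu (hVu h)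
      rw [indicator_of_notMem hxV, sub_zero]
      by_contra hne
      exact havoid x ⟨right_ne_zero_of_mul (left_ne_zero_of_mul hne), hxu⟩
        ⟨mem_of_indicator_ne_zero (right_ne_zero_of_mul hne), S.d_mem_unitSpace x, hxU⟩
        (mem_of_indicator_ne_zero (left_ne_zero_of_mul (left_ne_zero_of_mul hne)))
  have hcI : V.indicator (fun _ => c) ∈ I := by
    have := hI.2.2.1 _ hwI _ hdiff
    rwa [sub_sub_cancel] at this
  refine huD.2 ⟨V, hV, hVc, hVu, huV, ?_⟩
  have : S.conv (V.indicator fun _ => c⁻¹) (V.indicator fun _ => c) =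
      V.indicator fun _ => (1 : k) := by
    ext x
    rw [S.indicator_units_conv hVu]
    by_cases hx : x ∈ V
    · simp [S.r_of_mem_unitSpace (hVu hx), hx, hgγ]
    · simp [hx]
  rw [← this]
  exact hI.conv_left_mem (hVS _) hcI

end Topology

end GroupoidStr

/-- `[CH]`. Let `G` be a strongly effective Hausdorff ample groupoid
and `k` a field.  The correspondence `U ↦ I(U)` is a lattice isomorphism from the
lattice of open invariant subsets of `G⁰` onto the lattice of (two-sided) ideals of
`A_k(G)`. -/
theorem steinberg_ideal_lattice {G : Type*} [TopologicalSpace G]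
    (S : GroupoidStr G) [T2Space G] (hTop : S.IsTopological) (hAmple : S.IsAmple)
    (hSE : S.IsStronglyEffective) (k : Type*) [Field k] :
    (∀ U : Set G, S.IsRelOpen U → S.IsInvariant U → S.IsIdealOf (S.idealOf k U)) ∧
    Set.BijOn (fun U : Set G => S.idealOf k U)
      {U : Set G | S.IsRelOpen U ∧ S.IsInvariant U}
      {I : Set (G → k) | S.IsIdealOf I} ∧
    (∀ U V : Set G, S.IsRelOpen U → S.IsInvariant U → S.IsRelOpen V → S.IsInvariant V →
      (U ⊆ V ↔ S.idealOf k U ⊆ S.idealOf k V)) := by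
  have hord : ∀ U V : Set G, S.IsRelOpen U → S.IsInvariant U → S.IsRelOpen V →
      S.IsInvariant V → (U ⊆ V ↔ S.idealOf k U ⊆ S.idealOf k V) :=
    fun U V hU _ hV _ =>
      ⟨GroupoidStr.idealOf_mono, hAmple.subset_of_idealOf_subset hTop hU hV⟩
  refine ⟨fun U hU hinv => hAmple.isIdealOf_idealOf hTop hU hinv, ⟨?_, ?_, ?_⟩, hord⟩
  · rintro U ⟨hU, hinv⟩
    exact hAmple.isIdealOf_idealOf hTop hU hinv
  · rintro U ⟨hU, hUi⟩ V ⟨hV, hVi⟩ h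
    exact Subset.antisymm ((hord U V hU hUi hV hVi).2 h.subset)
      ((hord V U hV hVi hU hUi).2 h.superset)
  · intro I hI
    exact ⟨S.unitSupport I,
      ⟨GroupoidStr.isRelOpen_unitSupport I, hI.isInvariant_unitSupport hTop hAmple⟩,
      Subset.antisymm (hI.idealOf_unitSupport_subset hTop hAmple)
        (hI.subset_idealOf_unitSupport hTop hAmple hSE)⟩
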